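/- For every integer t ≥ 0 and all nonnegative integers a₁, …, a_t, the pair (u, v) given by the integer column vector (u, v)ᵀ = A^{a₁}·C·A^{a₂}·C·⋯·A^{a_t}·C·(1, 0)ᵀ is (a₁ + a₂ + ⋯ + a_t + t + 2)-feasible. -/

import Mathlib

open Matrix

/-- The number of spanning trees of a finite simple graph `G`: the number of
subgraphs `T ≤ G` (on the same vertex set) that are trees. -/
noncomputable def numSpanningTrees {V : Type} [Fintype V] (G : SimpleGraph V) : ℕ :=
  Set.ncard {T : SimpleGraph V | T ≤ G ∧ T.IsTree}

/-- A pair `(t, u)` of nonnegative integers is `n`-feasible if there is a simple graph `G`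
on at most `n` vertices with an edge `e` such that `t` is the number of spanning trees of
`G` containing `e` and `u` is the number of spanning trees of `G` not containing `e`. -/
def EdgeFeasible (n t u : ℕ) : Prop :=
  ∃ (m : ℕ) (G : SimpleGraph (Fin m)) (e : Sym2 (Fin m)),
    m ≤ n ∧ e ∈ G.edgeSet ∧
    t = Set.ncard {T : SimpleGraph (Fin m) | T ≤ G ∧ T.IsTree ∧ e ∈ T.edgeSet} ∧
    u = Set.ncard {T : SimpleGraph (Fin m) | T ≤ G ∧ T.IsTree ∧ e ∉ T.edgeSet}

/-- The matrix `A = [[1,1],[0,1]]` over the integers. -/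
def matA : Matrix (Fin 2) (Fin 2) ℤ := !![1, 1; 0, 1]

/-- The matrix `C = [[2,1],[1,1]]` over the integers. -/
def matC : Matrix (Fin 2) (Fin 2) ℤ := !![2, 1; 1, 1]

namespace SimpleGraph

variable {V W : Type} {G S : SimpleGraph V} {H : SimpleGraph W} {x y : V}

lemma Reachable.map_of_adj {f : V → W} (hf : ∀ a b, G.Adj a b → H.Reachable (f a) (f b))
    {a b : V} (h : G.Reachable a b) : H.Reachable (f a) (f b) := by
  obtain ⟨p⟩ := h
  induction p with
  | nil => rfl
  | cons hadj _ ih => exact (hf _ _ hadj).trans ih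

lemma Connected.of_adj_reachable (hG : G.Connected) (f : V → W)
    (hf : ∀ a b, G.Adj a b → H.Reachable (f a) (f b))
    (hs : ∀ w, ∃ v, H.Reachable (f v) w) : H.Connected := by
  obtain ⟨v₀⟩ := hG.nonempty
  refine (connected_iff_exists_forall_reachable H).2 ⟨f v₀, fun w => ?_⟩
  obtain ⟨v, hv⟩ := hs w
  exact ((hG.preconnected v₀ v).map_of_adj hf).trans hv

/-- The graph obtained from `S` by adding a new vertex `none` with neighbourhood `N`. -/
def extend (S : SimpleGraph V) (N : Set V) : SimpleGraph (Option V) where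
  Adj
    | none, none => False
    | none, some b => b ∈ N
    | some a, none => a ∈ N
    | some a, some b => S.Adj a b
  symm := ⟨by
    rintro (_ | a) (_ | b) h
    exacts [h, h, h, S.symm.symm _ _ h]⟩
  loopless := ⟨by
    rintro (_ | a) h
    exacts [h, S.loopless.irrefl a h]⟩

@[simp] lemma extend_adj_none_some {N : Set V} {b : V} :
    (S.extend N).Adj none (some b) ↔ b ∈ N := Iff.rfl

@[simp] lemma extend_adj_some_none {N : Set V} {b : V} :
    (S.extend N).Adj (some b) none ↔ b ∈ N := Iff.rfl

@[simp] lemma extend_adj_some_some {N : Set V} {a b : V} :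
    (S.extend N).Adj (some a) (some b) ↔ S.Adj a b := Iff.rfl

lemma extend_comap (T : SimpleGraph (Option V)) :
    (T.comap some).extend {a | T.Adj none (some a)} = T := by
  ext (_ | a) (_ | b) <;> simp [T.adj_comm]

lemma extend_left_injective (N : Set V) :
    Function.Injective fun S : SimpleGraph V => S.extend N := by
  intro S S' h
  ext a b
  simpa using congrArg (fun T : SimpleGraph (Option V) => T.Adj (some a) (some b)) h

lemma extend_le_extend {S S' : SimpleGraph V} {N N' : Set V} :
    S.extend N ≤ S'.extend N' ↔ S ≤ S' ∧ N ⊆ N' := by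
  constructor
  · intro h
    exact ⟨fun a b hab => @h (some a) (some b) hab, fun a ha => @h none (some a) ha⟩
  · rintro ⟨h, hN⟩ (_ | a) (_ | b) hab
    exacts [hab, hN hab, hN hab, h hab]

lemma card_edgeSet_extend [Finite V] (N : Set V) :
    Nat.card (S.extend N).edgeSet = Nat.card S.edgeSet + N.ncard := by
  have h : (S.extend N).edgeSet =
      Sym2.map some '' S.edgeSet ∪ (fun a => s(none, some a)) '' N := by
    ext e
    induction e with | _ a b
    constructor
    · rcases a with _ | a <;> rcases b with _ | b <;> intro h
      · exact h.elim
      · exact Or.inr ⟨b, h, rfl⟩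
      · exact Or.inr ⟨a, h, Sym2.eq_swap⟩
      · exact Or.inl ⟨s(a, b), h, rfl⟩
    · rintro (⟨e, he, h⟩ | ⟨c, hc, h⟩)
      · induction e with | _ c d
        rw [← h]
        exact he
      · rw [← h]
        exact hc
  have hd : Disjoint (Sym2.map some '' S.edgeSet) ((fun a : V => s(none, some a)) '' N) := by
    rw [Set.disjoint_left]
    rintro _ ⟨e, -, rfl⟩ ⟨c, -, h⟩
    induction e with | _ a b
    simp at h
  rw [Nat.card_coe_set_eq, Nat.card_coe_set_eq, h, Set.ncard_union_eq hd,
    Set.ncard_image_of_injective _ (Sym2.map.injective (Option.some_injective V)),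
    Set.ncard_image_of_injective]
  intro a b hab
  simpa using hab

lemma connected_extend_singleton : (S.extend {x}).Connected ↔ S.Connected := by
  constructor
  · intro h
    refine h.of_adj_reachable (fun o => o.getD x) ?_ fun w => ⟨some w, Reachable.refl _⟩
    rintro (_ | a) (_ | b) hab
    · rfl
    · obtain rfl : b = x := hab
      rfl
    · obtain rfl : a = x := hab
      rfl
    · exact Adj.reachable hab
  · intro h
    refine h.of_adj_reachable some (fun a b hab => Adj.reachable hab) ?_
    rintro (_ | w)
    · exact ⟨x, Adj.reachable (Set.mem_singleton x)⟩
    · exact ⟨w, Reachable.refl _⟩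

lemma connected_extend_pair (hxy : x ≠ y) :
    (S.extend {x, y}).Connected ↔ (S ⊔ edge x y).Connected := by
  have hE : (S ⊔ edge x y).Adj x y := Or.inr ((edge_adj ..).2 ⟨Or.inl ⟨rfl, rfl⟩, hxy⟩)
  constructor
  · intro h
    refine h.of_adj_reachable (fun o => o.getD x) ?_ fun w => ⟨some w, Reachable.refl _⟩
    rintro (_ | a) (_ | b) hab
    · rfl
    · rcases hab with rfl | rfl
      exacts [Reachable.refl _, hE.reachable]
    · rcases hab with rfl | rfl
      exacts [Reachable.refl _, hE.symm.reachable]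
    · exact Adj.reachable (Or.inl hab)
  · intro h
    have hx : (S.extend {x, y}).Adj (some x) none := Or.inl rfl
    have hy : (S.extend {x, y}).Adj (some y) none := Or.inr rfl
    have hr := hx.reachable.trans hy.symm.reachable
    refine h.of_adj_reachable some (fun a b hab => ?_) ?_
    · rcases hab with hab | hab
      · exact Adj.reachable hab
      · rcases ((edge_adj ..).1 hab).1 with ⟨rfl, rfl⟩ | ⟨rfl, rfl⟩
        exacts [hr, hr.symm]
    · rintro (_ | w)
      · exact ⟨x, hx.reachable⟩
      · exact ⟨w, Reachable.refl _⟩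

lemma isTree_extend_singleton [Finite V] : (S.extend {x}).IsTree ↔ S.IsTree := by
  simp only [isTree_iff_connected_and_card, connected_extend_singleton, card_edgeSet_extend,
    Set.ncard_singleton, Finite.card_option, Nat.add_right_cancel_iff]

lemma isTree_extend_pair [Finite V] (hxy : x ≠ y) :
    (S.extend {x, y}).IsTree ↔ ¬ S.Adj x y ∧ (S ⊔ edge x y).IsTree := by
  simp only [isTree_iff_connected_and_card, connected_extend_pair hxy, card_edgeSet_extend,
    Set.ncard_pair hxy, Finite.card_option]
  by_cases hS : S.Adj x y
  · have h : S ⊔ edge x y = S := sup_eq_left.2 ((edge_le_iff ..).2 (Or.inr hS))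
    rw [h]
    refine iff_of_false (fun ⟨hc, hn⟩ => ?_) (by simp [hS])
    have := hc.card_vert_le_card_edgeSet_add_one
    omega
  · have h : Nat.card (S ⊔ edge x y).edgeSet = Nat.card S.edgeSet + 1 := by
      rw [edgeSet_sup, edgeSet_edge_of_ne hxy, Nat.card_coe_set_eq,
        Nat.card_coe_set_eq, Set.union_singleton, Set.ncard_insert_of_notMem (s := S.edgeSet) hS]
    rw [h]
    simp only [hS, not_false_eq_true, true_and]
    constructor <;> rintro ⟨hc, hn⟩ <;> exact ⟨hc, by omega⟩

lemma IsTree.exists_adj_none [Nonempty V] {T : SimpleGraph (Option V)} (hT : T.IsTree) :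
    ∃ a, T.Adj none (some a) := by
  obtain ⟨v⟩ := ‹Nonempty V›
  obtain ⟨p⟩ := hT.connected.preconnected none (some v)
  cases p with
  | @cons _ w _ h _ =>
    rcases w with _ | a
    · exact (T.loopless.irrefl _ h).elim
    · exact ⟨a, h⟩

lemma setOf_isTree_not_adj_extend_pair [Finite V] (hxy : x ≠ y) :
    {T | T ≤ G.extend {x, y} ∧ T.IsTree ∧ ¬ T.Adj none (some x)} =
      (fun S : SimpleGraph V => S.extend {y}) '' {S | S ≤ G ∧ S.IsTree} := by
  have : Nonempty V := ⟨x⟩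
  ext T
  constructor
  · rintro ⟨hle, hT, hx⟩
    have hN : {a | T.Adj none (some a)} = {y} := by
      have hsub : ∀ a, T.Adj none (some a) → a = y := fun a ha =>
        (show a = x ∨ a = y from hle ha).resolve_left (by rintro rfl; exact hx ha)
      obtain ⟨a, ha⟩ := hT.exists_adj_none
      obtain rfl := hsub a ha
      exact Set.Subset.antisymm hsub (Set.singleton_subset_iff.2 ha)
    rw [← extend_comap T, hN] at hle hT ⊢
    exact ⟨_, ⟨(extend_le_extend.1 hle).1, isTree_extend_singleton.1 hT⟩, rfl⟩
  · rintro ⟨S, ⟨hle, hS⟩, rfl⟩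
    exact ⟨extend_le_extend.2 ⟨hle, by simp⟩, isTree_extend_singleton.2 hS, hxy⟩

lemma setOf_isTree_adj_extend_pair [Finite V] (hxy : x ≠ y) :
    {T | T ≤ G.extend {x, y} ∧ T.IsTree ∧ T.Adj none (some x)} =
      (fun S : SimpleGraph V => S.extend {x}) '' {S | S ≤ G ∧ S.IsTree} ∪
      (fun S : SimpleGraph V => S.extend {x, y}) ''
        {S | S ≤ G ∧ ¬ S.Adj x y ∧ (S ⊔ edge x y).IsTree} := by
  ext T
  constructor
  · rintro ⟨hle, hT, hx⟩
    have hsub : ∀ a, T.Adj none (some a) → a = x ∨ a = y := fun a ha => hle ha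
    by_cases hy : T.Adj none (some y)
    · have hN : {a | T.Adj none (some a)} = {x, y} :=
        Set.Subset.antisymm hsub (by rintro a (rfl | rfl) <;> assumption)
      rw [← extend_comap T, hN] at hle hT ⊢
      exact Or.inr ⟨_, ⟨(extend_le_extend.1 hle).1, (isTree_extend_pair hxy).1 hT⟩, rfl⟩
    · have hN : {a | T.Adj none (some a)} = {x} :=
        Set.Subset.antisymm
          (fun a ha => (hsub a ha).resolve_right (by rintro rfl; exact hy ha))
          (Set.singleton_subset_iff.2 hx)
      rw [← extend_comap T, hN] at hle hT ⊢
      exact Or.inl ⟨_, ⟨(extend_le_extend.1 hle).1, isTree_extend_singleton.1 hT⟩, rfl⟩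
  · rintro (⟨S, ⟨hle, hS⟩, rfl⟩ | ⟨S, ⟨hle, hS⟩, rfl⟩)
    · exact ⟨extend_le_extend.2 ⟨hle, by simp⟩, isTree_extend_singleton.2 hS, rfl⟩
    · exact ⟨extend_le_extend.2 ⟨hle, subset_rfl⟩, (isTree_extend_pair hxy).2 hS, Or.inl rfl⟩

lemma ncard_isTree_not_adj_extend_pair [Finite V] (hxy : x ≠ y) :
    {T | T ≤ G.extend {x, y} ∧ T.IsTree ∧ ¬ T.Adj none (some x)}.ncard =
      {S | S ≤ G ∧ S.IsTree}.ncard := by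
  rw [setOf_isTree_not_adj_extend_pair hxy,
    Set.ncard_image_of_injective _ (extend_left_injective _)]

lemma ncard_isTree_adj_extend_pair [Finite V] (hxy : x ≠ y) :
    {T | T ≤ G.extend {x, y} ∧ T.IsTree ∧ T.Adj none (some x)}.ncard =
      {S | S ≤ G ∧ S.IsTree}.ncard +
        {S | S ≤ G ∧ ¬ S.Adj x y ∧ (S ⊔ edge x y).IsTree}.ncard := by
  rw [setOf_isTree_adj_extend_pair hxy, Set.ncard_union_eq,
    Set.ncard_image_of_injective _ (extend_left_injective _),
    Set.ncard_image_of_injective _ (extend_left_injective _)]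
  rw [Set.disjoint_left]
  rintro _ ⟨S, -, rfl⟩ ⟨S', -, h⟩
  have hy : (S'.extend {x, y}).Adj none (some y) := Or.inr rfl
  have h' : S'.extend {x, y} = S.extend {x} := h
  rw [h'] at hy
  exact hxy (Eq.symm hy)

lemma ncard_isTree_sup_edge (hxy : G.Adj x y) :
    {S | S ≤ G ∧ ¬ S.Adj x y ∧ (S ⊔ edge x y).IsTree}.ncard =
      {T | T ≤ G ∧ T.IsTree ∧ T.Adj x y}.ncard := by
  have hE : (edge x y).Adj x y := (edge_adj ..).2 ⟨Or.inl ⟨rfl, rfl⟩, hxy.ne⟩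
  have hdel : ∀ T : SimpleGraph V, T.Adj x y → T \ edge x y ⊔ edge x y = T := fun T hT =>
    sdiff_sup_cancel ((edge_le_iff ..).2 (Or.inr hT))
  refine Set.ncard_congr (fun S _ => S ⊔ edge x y) ?_ ?_ ?_
  · rintro S ⟨hle, -, hT⟩
    exact ⟨sup_le hle ((edge_le_iff ..).2 (Or.inr hxy)), hT, Or.inr hE⟩
  · rintro S S' ⟨-, hS, -⟩ ⟨-, hS', -⟩ h
    have key : ∀ S : SimpleGraph V, ¬ S.Adj x y → (S ⊔ edge x y) \ edge x y = S := by
      intro S hS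
      refine Disjoint.sup_sdiff_cancel_right ?_
      rw [disjoint_edge]
      exact hS
    rw [← key S hS, ← key S' hS']
    exact congrArg (· \ edge x y) h
  · rintro T ⟨hle, hT, hadj⟩
    exact ⟨T \ edge x y, ⟨sdiff_le.trans hle, fun h => h.2 hE, by rwa [hdel T hadj]⟩,
      hdel T hadj⟩

/-- In `G`, the edge between `x` and `y` lies in exactly `t` spanning trees and is avoided by
exactly `u` spanning trees. -/
structure EdgeTreeCounts (G : SimpleGraph V) (x y : V) (t u : ℕ) : Prop where
  adj : G.Adj x y
  ncard_adj : {T | T ≤ G ∧ T.IsTree ∧ T.Adj x y}.ncard = t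
  ncard_not_adj : {T | T ≤ G ∧ T.IsTree ∧ ¬ T.Adj x y}.ncard = u

namespace EdgeTreeCounts

variable {t u : ℕ}

lemma ncard_isTree [Finite V] (h : G.EdgeTreeCounts x y t u) :
    {S | S ≤ G ∧ S.IsTree}.ncard = t + u := by
  rw [← h.ncard_adj, ← h.ncard_not_adj, ← Set.ncard_union_eq]
  · congr 1
    ext S
    simp only [Set.mem_ofPred_eq, Set.mem_union]
    tauto
  · exact Set.disjoint_left.2 fun _ h₁ h₂ => h₂.2.2 h₁.2.2

/-- Joining a new vertex to both ends of the edge. -/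
lemma extend_pair [Finite V] (h : G.EdgeTreeCounts x y t u) :
    (G.extend {x, y}).EdgeTreeCounts none (some x) (2 * t + u) (t + u) where
  adj := Or.inl rfl
  ncard_adj := by
    rw [ncard_isTree_adj_extend_pair h.adj.ne, ncard_isTree_sup_edge h.adj, h.ncard_isTree,
      h.ncard_adj]
    ring
  ncard_not_adj := by rw [ncard_isTree_not_adj_extend_pair h.adj.ne, h.ncard_isTree]

/-- Subdividing the edge by a new vertex. -/
lemma subdivide [Finite V] (h : G.EdgeTreeCounts x y t u) :
    ((G \ edge x y).extend {x, y}).EdgeTreeCounts none (some x) (t + u) u := by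
  have hle : ∀ S : SimpleGraph V, S ≤ G \ edge x y ↔ S ≤ G ∧ ¬ S.Adj x y := fun S => by
    rw [le_sdiff, disjoint_edge]
  have hu : {S | S ≤ G \ edge x y ∧ S.IsTree}.ncard = u := by
    rw [← h.ncard_not_adj]
    simp only [hle, and_assoc, and_comm (a := ¬ _)]
  refine ⟨Or.inl rfl, ?_, by rw [ncard_isTree_not_adj_extend_pair h.adj.ne, hu]⟩
  rw [ncard_isTree_adj_extend_pair h.adj.ne, hu, add_comm t, ← h.ncard_adj,
    ← ncard_isTree_sup_edge h.adj]
  simp only [hle, and_assoc, and_self_left]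

lemma map_equiv (h : G.EdgeTreeCounts x y t u) (f : V ≃ W) :
    (f.simpleGraph G).EdgeTreeCounts (f x) (f y) t u := by
  have hadj : ∀ (T : SimpleGraph V) a b, (f.simpleGraph T).Adj (f a) (f b) ↔ T.Adj a b := by
    intro T a b
    simp [Equiv.simpleGraph]
  have hle : ∀ S T : SimpleGraph V, f.simpleGraph S ≤ f.simpleGraph T ↔ S ≤ T := fun S T =>
    ⟨fun h a b hab => (hadj ..).1 (h ((hadj ..).2 hab)), fun h a b hab => h hab⟩
  have htree : ∀ T : SimpleGraph V, (f.simpleGraph T).IsTree ↔ T.IsTree := fun T =>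
    (Iso.isTree_iff ⟨f, by intro a b; exact hadj T a b⟩).symm
  refine ⟨(hadj ..).2 h.adj, ?_, ?_⟩
  · rw [← h.ncard_adj, ← Set.ncard_preimage_of_injective_subset_range f.simpleGraph.injective
      (by simp)]
    simp only [Set.preimage_ofPred_eq, hle, htree, hadj]
  · rw [← h.ncard_not_adj, ← Set.ncard_preimage_of_injective_subset_range
      f.simpleGraph.injective (by simp)]
    simp only [Set.preimage_ofPred_eq, hle, htree, hadj]

end EdgeTreeCounts

lemma edgeTreeCounts_top_bool : (⊤ : SimpleGraph Bool).EdgeTreeCounts false true 1 0 := by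
  have hT : ∀ T : SimpleGraph Bool, T.IsTree → T = ⊤ := by
    intro T hT
    have h := hT.connected.preconnected false true
    obtain ⟨p⟩ := h
    have hadj : T.Adj false true := by
      cases p with
      | @cons _ w _ h _ =>
        cases w
        · exact (T.loopless.irrefl _ h).elim
        · exact h
    ext a b
    cases a <;> cases b <;> simp [hadj, hadj.symm]
  have htop : (⊤ : SimpleGraph Bool).IsTree := by
    rw [isTree_iff_connected_and_card]
    refine ⟨connected_top, ?_⟩
    rw [Nat.card_eq_fintype_card, Nat.card_eq_fintype_card]
    decide
  refine ⟨by simp, ?_, ?_⟩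
  · rw [Set.ncard_eq_one]
    refine ⟨⊤, Set.ext fun T => ⟨fun h => hT T h.2.1, ?_⟩⟩
    rintro rfl
    exact ⟨le_rfl, htop, by simp⟩
  · rw [Set.ncard_eq_zero]
    refine Set.eq_empty_of_forall_notMem fun T h => ?_
    obtain rfl := hT T h.2.1
    exact h.2.2 (by simp)

end SimpleGraph

open SimpleGraph

lemma edgeFeasible_iff {n t u : ℕ} : EdgeFeasible n t u ↔
    ∃ (V : Type) (_ : Finite V) (G : SimpleGraph V) (x y : V),
      Nat.card V ≤ n ∧ G.EdgeTreeCounts x y t u := by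
  constructor
  · rintro ⟨m, G, e, hm, he, ht, hu⟩
    induction e with | _ x y
    exact ⟨Fin m, inferInstance, G, x, y, by simpa using hm, he, ht.symm, hu.symm⟩
  · rintro ⟨V, _, G, x, y, hV, h⟩
    let f := Finite.equivFin V
    have h' := h.map_equiv f
    exact ⟨_, f.simpleGraph G, s(f x, f y), hV, h'.adj, h'.ncard_adj.symm, h'.ncard_not_adj.symm⟩

lemma EdgeFeasible.extend_pair {n t u : ℕ} (h : EdgeFeasible n t u) :
    EdgeFeasible (n + 1) (2 * t + u) (t + u) := by
  obtain ⟨V, _, G, x, y, hV, h⟩ := edgeFeasible_iff.1 h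
  exact edgeFeasible_iff.2 ⟨Option V, inferInstance, _, _, _,
    by rw [Finite.card_option]; omega, h.extend_pair⟩

lemma EdgeFeasible.subdivide {n t u : ℕ} (h : EdgeFeasible n t u) :
    EdgeFeasible (n + 1) (t + u) u := by
  obtain ⟨V, _, G, x, y, hV, h⟩ := edgeFeasible_iff.1 h
  exact edgeFeasible_iff.2 ⟨Option V, inferInstance, _, _, _,
    by rw [Finite.card_option]; omega, h.subdivide⟩

lemma EdgeFeasible.subdivide_iterate {n t u : ℕ} (h : EdgeFeasible n t u) (k : ℕ) :
    EdgeFeasible (n + k) (t + k * u) u := by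
  induction k with
  | zero => simpa using h
  | succ k ih => simpa [add_mul, add_assoc] using ih.subdivide

lemma matA_pow_mulVec (k : ℕ) (p q : ℤ) : matA ^ k *ᵥ ![p, q] = ![p + k * q, q] := by
  induction k with
  | zero => simp
  | succ k ih =>
    rw [pow_succ', ← mulVec_mulVec, ih]
    ext i
    fin_cases i <;> simp [matA, mulVec, dotProduct, Fin.sum_univ_two]
    ring

lemma exists_edgeFeasible_word_vector (t : ℕ) (a : Fin t → ℕ) : ∃ u v : ℕ,
    (List.ofFn fun j => matA ^ (a j) * matC).prod *ᵥ ![1, 0] = ![(u : ℤ), (v : ℤ)] ∧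
      EdgeFeasible ((∑ j, a j) + t + 2) u v := by
  induction t with
  | zero =>
    exact ⟨1, 0, by simp, edgeFeasible_iff.2
      ⟨Bool, inferInstance, _, _, _, by simp, edgeTreeCounts_top_bool⟩⟩
  | succ t ih =>
    obtain ⟨u, v, huv, h⟩ := ih fun j => a j.succ
    refine ⟨2 * u + v + a 0 * (u + v), u + v, ?_, ?_⟩
    · have hC : matC *ᵥ ![(u : ℤ), (v : ℤ)] = ![2 * (u : ℤ) + v, (u : ℤ) + v] := by
        ext i
        fin_cases i <;> simp [matC, mulVec, dotProduct, Fin.sum_univ_two]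
      rw [List.ofFn_succ, List.prod_cons, ← mulVec_mulVec, huv, ← mulVec_mulVec, hC,
        matA_pow_mulVec]
      push_cast
      rfl
    · convert h.extend_pair.subdivide_iterate (a 0) using 1
      rw [Fin.sum_univ_succ]
      ring

/-- For every `t ≥ 0` and nonnegative integers `a₁, …, a_t`, the pair `(u,v)` given by
`(u,v)ᵀ = A^{a₁} C ⋯ A^{a_t} C (1,0)ᵀ` is `(a₁ + ⋯ + a_t + t + 2)`-feasible. -/
theorem word_vector_feasible (t : ℕ) (a : Fin t → ℕ) (u v : ℕ)
    (h : ![(u : ℤ), (v : ℤ)] = (List.ofFn fun j => matA ^ (a j) * matC).prod *ᵥ ![1, 0]) :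
    EdgeFeasible ((∑ j, a j) + t + 2) u v := by
  obtain ⟨u', v', huv, hf⟩ := exists_edgeFeasible_word_vector t a
  rw [huv] at h
  have hu : u = u' := by simpa using congrFun h 0
  have hv : v = v' := by simpa using congrFun h 1
  rwa [hu, hv]
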